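/- arXiv:2501.01894 — 2 statements merged into one kernel-verified Lean document; each statement's English description precedes it below -/
import Mathlib

section
/- Let (y_n)_{n ∈ ℤ} be a strictly increasing sequence of real numbers with y_n → +∞ as n → +∞ and y_n → −∞ as n → −∞. Assume that for every n ∈ ℤ there is no integer k with 2πk ≤ y_n and y_{n+1} ≤ 2π(k+1) (i.e., no interval [2πk, 2π(k+1)] of the standard partition contains both endpoints of any interval [y_n, y_{n+1}]). Then there exists a strictly increasing map m : ℤ → ℤ such that for every n ∈ ℤ: (a) the distance between the intervals [y_n, y_{n+1}] and [2π·m(n), 2π·(m(n)+1)] is at most 2π (they intersect or the gap between them has length at most 2π); and (b) m(n+1) − m(n) is odd, i.e., consecutive intervals are mapped to intervals of the standard partition that are adjacent or separated by an even number of partition intervals. -/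
open Real Set

noncomputable section

/-- The distance between the closed intervals `[a,b]` and `[c,d]`:
`inf {|x - y| : x ∈ [a,b], y ∈ [c,d]}`. -/
def intervalDist (a b c d : ℝ) : ℝ :=
  sInf {r | ∃ x ∈ Set.Icc a b, ∃ y ∈ Set.Icc c d, r = |x - y|}

/-- The distance between two intervals is bounded by the distance between any of their points. -/
lemma intervalDist_le_abs_sub {a b c d s t : ℝ} (hs : s ∈ Set.Icc a b) (ht : t ∈ Set.Icc c d) :
    intervalDist a b c d ≤ |s - t| :=
  csInf_le ⟨0, by rintro r ⟨x, -, z, -, rfl⟩; exact abs_nonneg _⟩ ⟨s, hs, t, ht, rfl⟩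

/-- Every half-open interval `[x - 2, x)` contains an integer of prescribed parity. -/
lemma exists_add_two_mul_mem_Ico (x : ℝ) (n : ℤ) :
    ∃ j : ℤ, x - 2 ≤ ((n + 2 * j : ℤ) : ℝ) ∧ ((n + 2 * j : ℤ) : ℝ) < x := by
  refine ⟨⌈(x - 2 - n) / 2⌉, ?_, ?_⟩ <;> push_cast
  · linarith [Int.le_ceil ((x - 2 - n) / 2)]
  · linarith [Int.ceil_lt_add_one ((x - 2 - n) / 2)]

/-- aligning a partition `([y n, y (n+1)])_{n ∈ ℤ}` of `ℝ` with the standard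
partition into intervals `[2πk, 2π(k+1)]`.  If no standard interval contains a whole
interval `[y n, y (n+1)]`, there is a strictly increasing `m : ℤ → ℤ` so that each
`[y n, y (n+1)]` is within distance `2π` of `[2π m(n), 2π(m(n)+1)]` and `m(n+1) - m(n)`
is odd. -/
theorem align_partitions (y : ℤ → ℝ) (hmono : StrictMono y)
    (htop : Filter.Tendsto y Filter.atTop Filter.atTop)
    (hbot : Filter.Tendsto y Filter.atBot Filter.atBot)
    (hno : ∀ n : ℤ, ¬ ∃ k : ℤ, 2 * π * k ≤ y n ∧ y (n + 1) ≤ 2 * π * (k + 1)) :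
    ∃ m : ℤ → ℤ, StrictMono m ∧ ∀ n : ℤ,
      intervalDist (y n) (y (n + 1)) (2 * π * m n) (2 * π * (m n + 1)) ≤ 2 * π ∧
      Odd (m (n + 1) - m n) := by
  have hpi : 0 < 2 * π := by positivity
  choose j hj using fun n : ℤ => exists_add_two_mul_mem_Ico (y n / (2 * π)) n
  set m : ℤ → ℤ := fun n => n + 2 * j n with hm
  have hlo (n : ℤ) : y n ≤ 2 * π * (m n + 2) := by
    rw [mul_comm, ← div_le_iff₀ hpi]
    linarith [(hj n).1]
  have hhi (n : ℤ) : 2 * π * m n < y n := by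
    rw [mul_comm, ← lt_div_iff₀ hpi]
    exact (hj n).2
  have hodd (n : ℤ) : Odd (m (n + 1) - m n) := ⟨j (n + 1) - j n, by simp only [hm]; ring⟩
  refine ⟨m, strictMono_int_of_lt_succ fun n => ?_, fun n => ⟨?_, hodd n⟩⟩
  · by_contra! hle
    have hlt : m (n + 1) + 1 ≤ m n := by
      obtain ⟨r, hr⟩ := hodd n
      lia
    refine hno n ⟨m n, (hhi n).le, (hlo (n + 1)).trans ?_⟩
    have : (m (n + 1) : ℝ) + 1 ≤ m n := by exact_mod_cast hlt
    exact mul_le_mul_of_nonneg_left (by linarith) hpi.le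
  · have hy : y n ∈ Set.Icc (y n) (y (n + 1)) := ⟨le_rfl, (hmono (lt_add_one n)).le⟩
    have hz : min (y n) (2 * π * (m n + 1)) ∈ Set.Icc (2 * π * m n) (2 * π * (m n + 1)) :=
      ⟨le_min (hhi n).le (by gcongr; linarith), min_le_right _ _⟩
    refine (intervalDist_le_abs_sub hy hz).trans ?_
    rw [abs_of_nonneg (sub_nonneg.2 (min_le_left _ _)), sub_le_comm]
    exact le_min (by linarith) (by linarith [hlo n])
end
end

section
/- There is an absolute constant C < ∞ with the following property. Let f be an injective holomorphic function on the right half-plane ℍ_r = {z ∈ ℂ : Re z > 0}, and for each n ∈ ℤ let Γ_n = f({1 + iy : 2πn ≤ y ≤ 2π(n+1)}) be the image of the n-th segment of length 2π on the vertical line {Re z = 1}. Then for every n ∈ ℤ, diam(Γ_n) ≤ C · diam(Γ_{n+1}) and diam(Γ_{n+1}) ≤ C · diam(Γ_n); that is, adjacent image arcs have comparable diameters with a uniform constant independent of f and n. -/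
open Real Set

noncomputable section

/-- The image under `f` of the `n`-th segment of length `2π` on the vertical line
`{Re z = 1}`: `Γ_n = f({1 + iy : 2πn ≤ y ≤ 2π(n+1)})`. -/
def segImage (f : ℂ → ℂ) (n : ℤ) : Set ℂ :=
  f '' {z : ℂ | ∃ y : ℝ, 2 * π * n ≤ y ∧ y ≤ 2 * π * (n + 1) ∧ z = 1 + y * Complex.I}

section Bloch

open Metric

/-- A weak form of **Bloch's theorem**: the image of a disc of radius `r` centred at `c` under a
holomorphic function contains a disc of radius comparable to `r * ‖f' c‖`. -/
theorem exists_ball_subset_image_ball {f : ℂ → ℂ} {c : ℂ} {r : ℝ} (hr : 0 < r)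
    (hf : DifferentiableOn ℂ f (ball c r)) :
    ∃ a ∈ ball c r, ball (f a) (r * ‖deriv f c‖ / 128) ⊆ f '' ball c r := by
  rcases eq_or_ne (deriv f c) 0 with h0 | h0
  · exact ⟨c, mem_ball_self hr, by simp [h0]⟩
  have hsub : closedBall c (r / 2) ⊆ ball c r := closedBall_subset_ball (by linarith)
  have hd : DifferentiableOn ℂ (deriv f) (ball c r) := hf.deriv isOpen_ball
  obtain ⟨a, ha, hmax⟩ := (isCompact_closedBall c (r / 2)).exists_isMaxOn
    (nonempty_closedBall.2 (by positivity))
    (f := fun z ↦ (r / 2 - dist z c) * ‖deriv f z‖)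
    ((continuousOn_const.sub (by fun_prop)).mul (hd.continuousOn.mono hsub).norm)
  have hmax' : ∀ z ∈ closedBall c (r / 2),
      (r / 2 - dist z c) * ‖deriv f z‖ ≤ (r / 2 - dist a c) * ‖deriv f a‖ := fun z hz ↦ hmax hz
  have hc := hmax' c (mem_closedBall_self (by positivity))
  rw [dist_self, sub_zero] at hc
  have hpos : 0 < (r / 2 - dist a c) * ‖deriv f a‖ :=
    lt_of_lt_of_le (mul_pos (by positivity) (norm_pos_iff.2 h0)) hc
  have hac : dist a c ≤ r / 2 := ha
  have hda : 0 < ‖deriv f a‖ := pos_of_mul_pos_right hpos (by linarith)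
  have ht0 : 0 < r / 2 - dist a c := pos_of_mul_pos_left hpos hda.le
  set D := ‖deriv f a‖ with hD
  set t := (r / 2 - dist a c) / 2 with ht
  have htpos : 0 < t := by positivity
  have hball : ball a t ⊆ closedBall c (r / 2) := fun z hz ↦ by
    have := dist_triangle z a c
    have hz' : dist z a < t := hz
    rw [mem_closedBall]; linarith
  have hbound : ∀ z ∈ ball a t, ‖deriv f z‖ ≤ 2 * D := fun z hz ↦ by
    have h1 := hmax' z (hball hz)
    have h2 := dist_triangle z a c
    have hz' : dist z a < t := hz
    have h3 : t * ‖deriv f z‖ ≤ t * (2 * D) := by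
      calc t * ‖deriv f z‖ ≤ (r / 2 - dist z c) * ‖deriv f z‖ := by gcongr; linarith
        _ ≤ _ := h1
        _ = t * (2 * D) := by rw [ht]; ring
    exact le_of_mul_le_mul_left h3 htpos
  have hmaps : MapsTo (deriv f) (ball a t) (closedBall (deriv f a) (4 * D)) := fun z hz ↦ by
    rw [mem_closedBall, dist_eq_norm]
    linarith [norm_sub_le (deriv f z) (deriv f a), hbound z hz]
  have hosc : ∀ z ∈ closedBall a (t / 8), ‖deriv f z - deriv f a‖ ≤ D / 2 := fun z hz ↦ by
    have hz' : dist z a ≤ t / 8 := hz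
    have h := Complex.dist_le_div_mul_dist_of_mapsTo_ball (hd.mono (hball.trans hsub)) hmaps
      (show z ∈ ball a t by rw [mem_ball]; linarith)
    rw [← dist_eq_norm]
    calc _ ≤ _ := h
      _ ≤ 4 * D / t * (t / 8) := by gcongr
      _ = D / 2 := by field_simp; norm_num
  have hsub8 : closedBall a (t / 8) ⊆ ball c r :=
    (closedBall_subset_ball (by linarith)).trans (hball.trans hsub)
  have hsphere : ∀ z ∈ sphere a (t / 8), D * t / 16 ≤ ‖f z - f a‖ := fun z hz ↦ by
    have hz' : ‖z - a‖ = t / 8 := by rw [← dist_eq_norm]; exact hz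
    have h := (convex_closedBall a (t / 8)).norm_image_sub_le_of_norm_hasDerivWithin_le
      (f := fun z ↦ f z - deriv f a * z) (f' := fun z ↦ deriv f z - deriv f a) (C := D / 2)
      (fun x hx ↦ by
        have h1 := (hf.differentiableAt (isOpen_ball.mem_nhds (hsub8 hx))).hasDerivAt
        simpa using! (h1.fun_sub ((hasDerivAt_id x).const_mul (deriv f a))).hasDerivWithinAt)
      hosc (mem_closedBall_self (by positivity)) (sphere_subset_closedBall hz)
    have h2 : ‖deriv f a * (z - a)‖ = D * (t / 8) := by rw [norm_mul, hz']
    have h3 := norm_sub_norm_le (deriv f a * (z - a)) (-(f z - deriv f a * z - (f a - deriv f a * a)))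
    rw [norm_neg, h2] at h3
    rw [hz'] at h
    have h4 : deriv f a * (z - a) - -(f z - deriv f a * z - (f a - deriv f a * a)) = f z - f a := by
      ring
    rw [h4] at h3
    linarith
  have hne : ∃ᶠ z in nhds a, f z ≠ f a := by
    intro h
    have h' : f =ᶠ[nhds a] fun _ ↦ f a := h.mono fun z hz ↦ not_not.1 hz
    have := h'.deriv_eq
    simp only [deriv_const] at this
    simp [hD, this] at hda
  have hdc : DiffContOnCl ℂ f (ball a (t / 8)) :=
    (hf.mono (closure_ball_subset_closedBall.trans hsub8)).diffContOnCl
  refine ⟨a, hsub ha, ?_⟩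
  have hle : r * ‖deriv f c‖ / 128 ≤ D * t / 16 / 2 := by
    have : D * t = (r / 2 - dist a c) * D / 2 := by rw [ht]; ring
    linarith
  exact (ball_subset_ball hle).trans
    ((hdc.ball_subset_image_closedBall (by positivity) hsphere hne).trans (image_mono hsub8))

/-- A nowhere vanishing holomorphic function on a disc has a holomorphic logarithm. -/
theorem exists_differentiableOn_exp_eq {f : ℂ → ℂ} {c : ℂ} {r : ℝ} (hr : 0 < r)
    (hf : DifferentiableOn ℂ f (ball c r)) (h0 : ∀ z ∈ ball c r, f z ≠ 0) :
    ∃ g : ℂ → ℂ, (∀ z ∈ ball c r, HasDerivAt g (deriv f z / f z) z) ∧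
      ∀ z ∈ ball c r, Complex.exp (g z) = f z := by
  obtain ⟨g, hgc, hg⟩ := (((hf.deriv isOpen_ball).div hf h0).isExactOn_ball).with_val_at c
    (Complex.log (f c))
  refine ⟨g, hg, fun z hz ↦ ?_⟩
  have hder : ∀ z ∈ ball c r, HasDerivAt (fun z ↦ f z * Complex.exp (-g z)) 0 z := fun z hz ↦ by
    have h1 := (hf.differentiableAt (isOpen_ball.mem_nhds hz)).hasDerivAt
    convert! h1.mul (hg z hz).neg.cexp using 1
    have := h0 z hz
    simp only [Pi.div_apply]
    field_simp
    ring
  have hconst := isOpen_ball.is_const_of_deriv_eq_zero (convex_ball c r).isPreconnected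
    (fun x hx ↦ (hder x hx).differentiableAt.differentiableWithinAt)
    (fun x hx ↦ (hder x hx).deriv) hz (mem_ball_self hr)
  have hc1 : f c * Complex.exp (-g c) = 1 := by
    rw [Complex.exp_neg, hgc, Complex.exp_log (h0 c (mem_ball_self hr)),
      mul_inv_cancel₀ (h0 c (mem_ball_self hr))]
  have hconst := hconst.trans hc1
  rw [Complex.exp_neg] at hconst
  exact (eq_of_div_eq_one (by rwa [div_eq_mul_inv])).symm

/-- A weak form of the **Koebe quarter theorem**: a value omitted by an injective holomorphic
function on a disc is at distance at least a multiple of `r * ‖f' c‖` from `f c`. -/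
theorem norm_deriv_le_of_injOn_of_notMem {f : ℂ → ℂ} {c w : ℂ} {r : ℝ} (hr : 0 < r)
    (hf : DifferentiableOn ℂ f (ball c r)) (hinj : InjOn f (ball c r)) (hw : w ∉ f '' ball c r) :
    r * ‖deriv f c‖ ≤ 256 * π * ‖f c - w‖ := by
  have hne : ∀ z ∈ ball c r, f z - w ≠ 0 := fun z hz h ↦ hw ⟨z, hz, sub_eq_zero.1 h⟩
  obtain ⟨g, hg, hexp⟩ := exists_differentiableOn_exp_eq hr (hf.sub_const w) hne
  obtain ⟨a, ha, hsub⟩ := exists_ball_subset_image_ball hr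
    (fun z hz ↦ (hg z hz).differentiableAt.differentiableWithinAt)
  have hc := mem_ball_self (x := c) hr
  have hcpos : 0 < ‖f c - w‖ := norm_pos_iff.2 (hne c hc)
  by_contra! hlt
  have hmem : g a + 2 * π * Complex.I ∈ ball (g a) (r * ‖deriv g c‖ / 128) := by
    rw [(hg c hc).deriv, deriv_sub_const, norm_div, mem_ball, dist_eq_norm, add_sub_cancel_left]
    have : ‖(2 * π * Complex.I : ℂ)‖ = 2 * π := by simp [Real.pi_pos.le]
    rw [this, lt_div_iff₀ (by norm_num), ← mul_div_assoc, lt_div_iff₀ hcpos]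
    linarith
  obtain ⟨b, hb, hba⟩ := hsub hmem
  have hfab : f b = f a := by
    have := hexp b hb
    rw [hba, Complex.exp_periodic, hexp a ha] at this
    exact (sub_left_inj.1 this).symm
  rw [hinj hb ha hfab, left_eq_add] at hba
  exact Complex.two_pi_I_ne_zero hba

end Bloch

section Inverse

open Filter Topology

/-- A left inverse of an injective holomorphic function is holomorphic on the image. -/
theorem Set.LeftInvOn.differentiableOn_image {f g : ℂ → ℂ} {U : Set ℂ} (hU : IsOpen U)
    (hf : DifferentiableOn ℂ f U) (hg : LeftInvOn g f U) : DifferentiableOn ℂ g (f '' U) := by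
  have han : ∀ a ∈ U, AnalyticAt ℂ f a := fun a ha ↦ hf.analyticAt (hU.mem_nhds ha)
  have hnc : ∀ a ∈ U, ¬ ∀ᶠ z in 𝓝 a, f z = f a := fun a ha h ↦ by
    have h' : ∀ᶠ z in 𝓝 a, z = a := by
      filter_upwards [h, hU.mem_nhds ha] with z hz hzU using hg.injOn hzU ha hz
    obtain ⟨z, hz, hza⟩ := ((h'.filter_mono nhdsWithin_le_nhds).and
      (self_mem_nhdsWithin : {a}ᶜ ∈ 𝓝[≠] a)).exists
    exact hza hz
  have hopen : ∀ a ∈ U, 𝓝 (f a) ≤ map f (𝓝 a) := fun a ha ↦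
    ((han a ha).eventually_constant_or_nhds_le_map_nhds).resolve_left (hnc a ha)
  have hcont : ∀ a ∈ U, ContinuousAt g (f a) := fun a ha ↦ by
    have h1 : Tendsto (g ∘ f) (𝓝 a) (𝓝 a) := tendsto_id.congr' <| by
      filter_upwards [hU.mem_nhds ha] with z hz using (hg hz).symm
    rw [ContinuousAt, hg ha]
    exact (map_mono (hopen a ha)).trans (by rwa [map_map])
  have himg : ∀ a ∈ U, f '' U ∈ 𝓝 (f a) := fun a ha ↦
    hopen a ha (mem_map.2 (mem_of_superset (hU.mem_nhds ha) (subset_preimage_image f U)))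
  have hfg : ∀ w ∈ f '' U, f (g w) = w := by
    rintro _ ⟨z, hz, rfl⟩
    rw [hg hz]
  have hdiff : ∀ a ∈ U, deriv f a ≠ 0 → DifferentiableAt ℂ g (f a) := fun a ha h ↦ by
    refine (HasDerivAt.of_local_left_inverse (f := f) (f' := deriv f a) (hcont a ha) ?_ h
      (mem_of_superset (himg a ha) hfg)).differentiableAt
    rw [hg ha]
    exact (han a ha).differentiableAt.hasDerivAt
  rintro _ ⟨a, ha, rfl⟩
  refine DifferentiableAt.differentiableWithinAt (AnalyticAt.differentiableAt ?_)
  refine Complex.analyticAt_of_differentiable_on_punctured_nhds_of_continuousAt ?_ (hcont a ha)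
  have hcrit : ∀ᶠ z in 𝓝[≠] a, deriv f z ≠ 0 := by
    refine ((han a ha).deriv.eventually_eq_zero_or_eventually_ne_zero).resolve_left fun h ↦ ?_
    obtain ⟨ε, hε, hball⟩ := Metric.eventually_nhds_iff_ball.1 (h.and (hU.mem_nhds ha))
    refine hnc a ha ?_
    filter_upwards [Metric.ball_mem_nhds a hε] with z hz
    exact Metric.isOpen_ball.is_const_of_deriv_eq_zero (convex_ball a ε).isPreconnected
      (hf.mono fun x hx ↦ (hball x hx).2) (fun x hx ↦ (hball x hx).1) hz (Metric.mem_ball_self hε)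
  rw [eventually_nhdsWithin_iff] at hcrit ⊢
  have hg' : Tendsto g (𝓝 (f a)) (𝓝 a) := by simpa only [ContinuousAt, hg ha] using hcont a ha
  filter_upwards [hg'.eventually hcrit, himg a ha] with w hw hwU hwa
  obtain ⟨z, hz, rfl⟩ := hwU
  rw [hg hz] at hw
  exact hdiff z hz (hw fun h ↦ hwa (by rw [mem_singleton_iff.1 h]; rfl))

end Inverse

section HalfPlane

open Metric ComplexConjugate

theorem Complex.isOpen_re_pos : IsOpen {z : ℂ | 0 < z.re} :=
  isOpen_lt continuous_const Complex.continuous_re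

theorem Complex.norm_sub_le_norm_add_conj {a z : ℂ} (ha : 0 < a.re) (hz : 0 < z.re) :
    ‖z - a‖ ≤ ‖z + conj a‖ := by
  rw [← sq_le_sq₀ (norm_nonneg _) (norm_nonneg _), ← Complex.normSq_eq_norm_sq,
    ← Complex.normSq_eq_norm_sq, Complex.normSq_apply, Complex.normSq_apply]
  simp
  nlinarith [mul_pos ha hz]

/-- The **Schwarz lemma** for the inverse of an injective holomorphic function on the right
half-plane whose image contains a disc. -/
theorem mul_norm_sub_le_of_ball_subset_image {f : ℂ → ℂ}
    (hf : DifferentiableOn ℂ f {z : ℂ | 0 < z.re}) (hinj : InjOn f {z : ℂ | 0 < z.re})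
    {a b : ℂ} (ha : 0 < a.re) (hb : 0 < b.re) {d : ℝ} (hd : 0 < d)
    (hsub : ball (f a) d ⊆ f '' {z : ℂ | 0 < z.re}) :
    d * ‖b - a‖ ≤ ‖b + conj a‖ * ‖f b - f a‖ := by
  rcases le_or_gt d ‖f b - f a‖ with h | h
  · rw [mul_comm]
    gcongr
    exact Complex.norm_sub_le_norm_add_conj ha hb
  set g := Function.invFunOn f {z : ℂ | 0 < z.re}
  have hg : LeftInvOn g f {z : ℂ | 0 < z.re} := hinj.leftInvOn_invFunOn
  have hgd := (hg.differentiableOn_image Complex.isOpen_re_pos hf).mono hsub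
  have hgpos : ∀ w ∈ ball (f a) d, 0 < (g w).re := fun w hw ↦ by
    obtain ⟨z, hz, rfl⟩ := hsub hw
    rw [hg hz]; exact hz
  have hne : ∀ z : ℂ, 0 < z.re → z + conj a ≠ 0 := fun z hz h0 ↦ by
    have := congrArg Complex.re h0
    simp at this
    linarith
  have hga : g (f a) = a := hg ha
  have hS := Complex.dist_le_div_mul_dist_of_mapsTo_ball
    (f := fun w ↦ (g w - a) / (g w + conj a)) (R₂ := 1) (z := f b)
    ((hgd.sub_const a).div (hgd.add_const _) fun w hw ↦ hne _ (hgpos w hw))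
    (fun w hw ↦ by
      rw [mem_closedBall, hga, sub_self, zero_div, dist_zero_right, norm_div]
      exact div_le_one_of_le₀ (Complex.norm_sub_le_norm_add_conj ha (hgpos w hw)) (norm_nonneg _))
    (by rwa [mem_ball, dist_eq_norm])
  simp only [hga, hg hb, sub_self, zero_div, norm_div, dist_eq_norm, sub_zero] at hS
  have hpos : 0 < ‖b + conj a‖ := norm_pos_iff.2 (hne b hb)
  rw [div_le_iff₀ hpos, div_mul_eq_mul_div, one_mul, div_mul_eq_mul_div, le_div_iff₀ hd] at hS
  linarith

/-- The distance from `f z` to an omitted value grows at most exponentially along the line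
`{Re z = 1}`. -/
theorem norm_sub_le_mul_exp_of_notMem {f : ℂ → ℂ}
    (hf : DifferentiableOn ℂ f {z : ℂ | 0 < z.re}) (hinj : InjOn f {z : ℂ | 0 < z.re})
    {w p z : ℂ} (hw : w ∉ f '' {z : ℂ | 0 < z.re}) (hp : p.re = 1) (hz : z.re = 1) :
    ‖f z - w‖ ≤ ‖f p - w‖ * Real.exp (256 * π * ‖z - p‖) := by
  set γ : ℝ → ℂ := fun t ↦ p + t * (z - p)
  have hγ : ∀ t, (γ t).re = 1 := fun t ↦ by simp [γ, hp, hz]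
  have hγ' : ∀ t, HasDerivAt γ (z - p) t := fun t ↦ by
    have h := ((Complex.ofRealCLM.hasDerivAt (x := t)).mul_const (z - p)).const_add p
    rwa [Complex.ofRealCLM_apply, Complex.ofReal_one, one_mul] at h
  have hder : ∀ t, HasDerivAt (fun t ↦ f (γ t) - w) (deriv f (γ t) * (z - p)) t := fun t ↦ by
    have h1 : HasDerivAt f (deriv f (γ t)) (γ t) := (hf.differentiableAt
      (Complex.isOpen_re_pos.mem_nhds (by simp [hγ t]))).hasDerivAt
    exact (h1.comp t (hγ' t)).sub_const w
  have hsub : ∀ t, ball (γ t) 1 ⊆ {z : ℂ | 0 < z.re} := fun t x hx ↦ by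
    rw [mem_ball, dist_eq_norm] at hx
    have := (abs_le.1 (Complex.abs_re_le_norm (x - γ t))).1
    rw [Complex.sub_re, hγ t] at this
    rw [mem_ofPred_eq]
    linarith
  have hgr := norm_le_gronwallBound_of_norm_deriv_right_le (a := 0) (b := 1) (ε := 0)
    (K := 256 * π * ‖z - p‖) (δ := ‖f p - w‖) (f := fun t ↦ f (γ t) - w)
    (fun t _ ↦ (hder t).continuousAt.continuousWithinAt) (fun t _ ↦ (hder t).hasDerivWithinAt)
    (by simp [γ]) (fun t _ ↦ by
      have := norm_deriv_le_of_injOn_of_notMem one_pos (hf.mono (hsub t)) (hinj.mono (hsub t))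
        (fun h ↦ hw (image_mono (hsub t) h))
      rw [one_mul] at this
      rw [norm_mul, add_zero]
      calc _ ≤ 256 * π * ‖f (γ t) - w‖ * ‖z - p‖ := by gcongr
        _ = _ := by ring) 1 (by simp)
  simpa [γ, gronwallBound_ε0] using hgr

theorem diam_image_le_mul_norm_sub {f : ℂ → ℂ}
    (hf : DifferentiableOn ℂ f {z : ℂ | 0 < z.re}) (hinj : InjOn f {z : ℂ | 0 < z.re})
    {p q : ℂ} (hp : p.re = 1) (hq : q.re = 1) (hpq : ‖q - p‖ = 2 * π) {T : Set ℂ}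
    (hT : ∀ z ∈ T, z.re = 1 ∧ ‖z - p‖ ≤ 2 * π) :
    diam (f '' T) ≤ 4 * (1 + Real.exp (256 * π * (2 * π))) * ‖f q - f p‖ := by
  have hp' : 0 < p.re := by simp [hp]
  have hq' : 0 < q.re := by simp [hq]
  have hδ : 0 < ‖f q - f p‖ := by
    refine norm_pos_iff.2 (sub_ne_zero.2 fun h ↦ ?_)
    rw [hinj hq' hp' h, sub_self, norm_zero] at hpq
    linarith [Real.pi_pos]
  obtain ⟨w, hwb, hw⟩ : ∃ w ∈ ball (f p) (2 * ‖f q - f p‖), w ∉ f '' {z : ℂ | 0 < z.re} := by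
    by_contra! h
    have h1 := mul_norm_sub_le_of_ball_subset_image hf hinj hp' hq' (by positivity) h
    have h2 : ‖q + conj p‖ ≤ 2 + 2 * π := by
      have h3 : q + conj p = 2 + (q - p) := by
        apply Complex.ext
        · simp [hp, hq]
          norm_num
        · simp [sub_eq_add_neg]
      rw [h3, ← hpq]
      exact (norm_add_le _ _).trans (by simp)
    have h4 := h1.trans (mul_le_mul_of_nonneg_right h2 hδ.le)
    rw [hpq] at h4
    nlinarith [Real.pi_gt_three]
  rw [mem_ball, dist_eq_norm, norm_sub_rev] at hwb
  have hdist : ∀ z ∈ T,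
      dist (f z) w ≤ 2 * (1 + Real.exp (256 * π * (2 * π))) * ‖f q - f p‖ := fun z hz ↦ by
    rw [dist_eq_norm]
    calc ‖f z - w‖ ≤ ‖f p - w‖ * Real.exp (256 * π * ‖z - p‖) :=
          norm_sub_le_mul_exp_of_notMem hf hinj hw hp (hT z hz).1
      _ ≤ 2 * ‖f q - f p‖ * Real.exp (256 * π * (2 * π)) := by
          gcongr
          exact (hT z hz).2
      _ ≤ _ := by linarith
  refine diam_le_of_forall_dist_le (by positivity) ?_
  rintro _ ⟨x, hx, rfl⟩ _ ⟨y, hy, rfl⟩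
  linarith [dist_triangle_right (f x) (f y) w, hdist x hx, hdist y hy]

theorem norm_sub_le_diam_segImage {f : ℂ → ℂ} (hf : DifferentiableOn ℂ f {z : ℂ | 0 < z.re})
    {n : ℤ} {x y : ℝ} (hx : x ∈ Icc (2 * π * n) (2 * π * (n + 1)))
    (hy : y ∈ Icc (2 * π * n) (2 * π * (n + 1))) :
    ‖f (1 + x * Complex.I) - f (1 + y * Complex.I)‖ ≤ diam (segImage f n) := by
  have heq : segImage f n =
      (fun y : ℝ ↦ f (1 + y * Complex.I)) '' Icc (2 * π * n) (2 * π * (n + 1)) := by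
    ext w
    constructor
    · rintro ⟨_, ⟨y, h1, h2, rfl⟩, rfl⟩
      exact ⟨y, ⟨h1, h2⟩, rfl⟩
    · rintro ⟨y, ⟨h1, h2⟩, rfl⟩
      exact ⟨_, ⟨y, h1, h2, rfl⟩, rfl⟩
  have hb : Bornology.IsBounded (segImage f n) := by
    rw [heq]
    refine (isCompact_Icc.image_of_continuousOn ?_).isBounded
    exact hf.continuousOn.comp (by fun_prop) fun y _ ↦ by simp
  rw [← dist_eq_norm]
  exact dist_le_diam_of_mem hb ⟨_, ⟨x, hx.1, hx.2, rfl⟩, rfl⟩ ⟨_, ⟨y, hy.1, hy.2, rfl⟩, rfl⟩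

end HalfPlane

/-- there is an absolute constant `C` so that for every injective holomorphic
function `f` on the right half-plane, adjacent image arcs `Γ_n = f([1 + 2πin, 1 + 2πi(n+1)])`
have comparable diameters: `diam Γ_n ≤ C · diam Γ_{n+1}` and `diam Γ_{n+1} ≤ C · diam Γ_n`. -/
theorem adjacent_image_arcs_comparable :
    ∃ C : ℝ, ∀ f : ℂ → ℂ,
      DifferentiableOn ℂ f {z : ℂ | 0 < z.re} →
      Set.InjOn f {z : ℂ | 0 < z.re} →
      ∀ n : ℤ,
        Metric.diam (segImage f n) ≤ C * Metric.diam (segImage f (n + 1)) ∧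
        Metric.diam (segImage f (n + 1)) ≤ C * Metric.diam (segImage f n) := by
  refine ⟨4 * (1 + Real.exp (256 * π * (2 * π))), fun f hf hinj n ↦ ?_⟩
  have hπ := Real.pi_pos
  have hnorm : ∀ x y : ℝ, ‖(1 + x * Complex.I) - (1 + y * Complex.I)‖ = |x - y| := fun x y ↦ by
    rw [add_sub_add_left_eq_sub, ← sub_mul, norm_mul, Complex.norm_I, mul_one,
      ← Complex.ofReal_sub, Complex.norm_real, Real.norm_eq_abs]
  constructor
  · refine (diam_image_le_mul_norm_sub hf hinj
      (p := 1 + (2 * π * (n + 1) : ℝ) * Complex.I) (q := 1 + (2 * π * (n + 2) : ℝ) * Complex.I)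
      (by simp) (by simp) ?_ ?_).trans (mul_le_mul_of_nonneg_left
        (norm_sub_le_diam_segImage hf ⟨?_, ?_⟩ ⟨?_, ?_⟩) (by positivity))
    · rw [hnorm, abs_of_nonneg] <;> nlinarith
    · rintro _ ⟨y, h1, h2, rfl⟩
      refine ⟨by simp, ?_⟩
      rw [hnorm, abs_le]
      constructor <;> nlinarith
    all_goals push_cast; nlinarith
  · refine (diam_image_le_mul_norm_sub hf hinj
      (p := 1 + (2 * π * (n + 1) : ℝ) * Complex.I) (q := 1 + (2 * π * n : ℝ) * Complex.I)
      (by simp) (by simp) ?_ ?_).trans (mul_le_mul_of_nonneg_left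
        (norm_sub_le_diam_segImage hf ⟨?_, ?_⟩ ⟨?_, ?_⟩) (by positivity))
    · rw [hnorm, abs_of_nonpos] <;> nlinarith
    · rintro _ ⟨y, h1, h2, rfl⟩
      push_cast at h1 h2
      refine ⟨by simp, ?_⟩
      rw [hnorm, abs_le]
      constructor <;> nlinarith
    all_goals nlinarith
end
end
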